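/- Let f be a Cohn–Elkies function of dimension n and size ℓ_L for a lattice L ⊂ ℝ^n with shortest length ℓ_L, and suppose additionally that 1/covol(L) = f(0)/𝔉f(0). Then f(λ) = 0 for every nonzero λ ∈ L and 𝔉f(λ') = 0 for every nonzero λ' in the dual lattice L^∨. -/

import Mathlib

open MeasureTheory Real
open scoped FourierTransform RealInnerProductSpace

noncomputable section

/-- The integer vector `m` seen as a real vector. -/
def cvec {n : ℕ} (m : Fin n → ℤ) : Fin n → ℝ := fun i => (m i : ℝ)

lemma cvec_inj {n : ℕ} : Function.Injective (cvec (n := n)) := by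
  intro a b h
  funext i
  have := congrFun h i
  simpa [cvec] using this

lemma cvec_mem {n : ℕ} (m : Fin n → ℤ) :
    cvec m ∈ Submodule.span ℤ (Set.range (Pi.basisFun ℝ (Fin n))) := by
  rw [Module.Basis.mem_span_iff_repr_mem]
  intro i
  exact ⟨m i, by simp [cvec]⟩

lemma summable_cvec (n : ℕ) :
    Summable fun m : Fin n → ℤ => ((1 + ‖cvec m‖) ^ (n + 1))⁻¹ := by
  have h1 := ZLattice.summable_norm_pow_inv
    (Submodule.span ℤ (Set.range (Pi.basisFun ℝ (Fin n)))) (n + 1)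
    (by rw [ZLattice.rank ℝ]; simp)
  have h2 : Function.Injective (fun m : Fin n → ℤ =>
      (⟨cvec m, cvec_mem m⟩ : Submodule.span ℤ (Set.range (Pi.basisFun ℝ (Fin n))))) := by
    intro a b h
    exact cvec_inj (congrArg Subtype.val h)
  have h3 := h1.comp_injective h2
  have h4 : Summable fun m : Fin n → ℤ => if m = 0 then (1 : ℝ) else 0 :=
    (hasSum_ite_eq 0 (1 : ℝ)).summable
  refine Summable.of_nonneg_of_le (fun m => by positivity) (fun m => ?_) (h3.add h4)
  by_cases hm : m = 0
  · subst hm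
    have : cvec (0 : Fin n → ℤ) = 0 := by funext i; simp [cvec]
    simp [this]
  · have h0 : 0 < ‖cvec m‖ := by
      rw [norm_pos_iff]
      intro h
      apply hm
      apply cvec_inj
      rw [h]; funext i; simp [cvec]
    simp only [hm, if_false, add_zero, Function.comp_apply, Submodule.coe_norm]
    rw [inv_pow]
    gcongr
    linarith

lemma schwartz_bound {n : ℕ} (g : SchwartzMap (Fin n → ℝ) ℂ) :
    ∃ C : ℝ, 0 ≤ C ∧ ∀ (x : Fin n → ℝ) (m : Fin n → ℤ),
      ‖g (x + cvec m)‖ ≤ C * (1 + ‖x‖) ^ (n + 1) * ((1 + ‖cvec m‖) ^ (n + 1))⁻¹ := by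
  obtain ⟨C, hC⟩ : ∃ C : ℝ, ∀ x, (1 + ‖x‖) ^ (n + 1) * ‖g x‖ ≤ C := by
    refine ⟨2 ^ (n + 1) * ((Finset.Iic (n + 1, 0)).sup
      fun m => SchwartzMap.seminorm ℝ m.1 m.2) g, fun x => ?_⟩
    have := SchwartzMap.one_add_le_sup_seminorm_apply (𝕜 := ℝ) (m := (n + 1, 0)) le_rfl le_rfl g x
    rw [norm_iteratedFDeriv_zero] at this
    exact this
  refine ⟨C, le_trans (by positivity) (hC 0), fun x m => ?_⟩
  have hC0 : 0 ≤ C := le_trans (by positivity) (hC 0)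
  rw [← div_eq_mul_inv, le_div_iff₀ (by positivity)]
  have h1 : 1 + ‖cvec m‖ ≤ (1 + ‖x + cvec m‖) * (1 + ‖x‖) := by
    have : ‖cvec m‖ ≤ ‖x + cvec m‖ + ‖x‖ := by
      have := norm_sub_le (x + cvec m) x
      simpa using this
    nlinarith [norm_nonneg x, norm_nonneg (x + cvec m)]
  calc ‖g (x + cvec m)‖ * (1 + ‖cvec m‖) ^ (n + 1)
      ≤ ‖g (x + cvec m)‖ * ((1 + ‖x + cvec m‖) * (1 + ‖x‖)) ^ (n + 1) := by gcongr
    _ = ((1 + ‖x + cvec m‖) ^ (n + 1) * ‖g (x + cvec m)‖) * (1 + ‖x‖) ^ (n + 1) := by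
        rw [mul_pow]; ring
    _ ≤ C * (1 + ‖x‖) ^ (n + 1) := by gcongr; exact hC _

lemma schwartz_summable {n : ℕ} (g : SchwartzMap (Fin n → ℝ) ℂ) (x : Fin n → ℝ) :
    Summable fun m : Fin n → ℤ => g (x + cvec m) := by
  obtain ⟨C, hC0, hC⟩ := schwartz_bound g
  exact Summable.of_norm_bounded ((summable_cvec n).mul_left _) (hC x)

lemma schwartz_periodization_continuous {n : ℕ} (g : SchwartzMap (Fin n → ℝ) ℂ) :
    Continuous fun x : Fin n → ℝ => ∑' m : Fin n → ℤ, g (x + cvec m) := by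
  obtain ⟨C, hC0, hC⟩ := schwartz_bound g
  rw [continuous_iff_continuousAt]
  intro x₀
  have : ContinuousOn (fun x : Fin n → ℝ => ∑' m : Fin n → ℤ, g (x + cvec m))
      (Metric.ball 0 (‖x₀‖ + 1)) := by
    refine continuousOn_tsum (u := fun m => C * (1 + (‖x₀‖ + 1)) ^ (n + 1) *
      ((1 + ‖cvec m‖) ^ (n + 1))⁻¹) (fun m => ?_) ((summable_cvec n).mul_left _) ?_
    · exact (g.continuous.comp (by fun_prop)).continuousOn
    · intro m x hx
      refine (hC x m).trans ?_
      have : ‖x‖ ≤ ‖x₀‖ + 1 := by simpa using (Metric.mem_ball.mp hx).le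
      gcongr
  exact this.continuousAt (Metric.isOpen_ball.mem_nhds (by simp))

/-- Half-open unit cubes. -/
def cube {n : ℕ} (a : Fin n → ℝ) : Set (Fin n → ℝ) := {x | ∀ i, x i ∈ Set.Ioc (a i) (a i + 1)}

lemma cube_meas {n : ℕ} (a : Fin n → ℝ) : MeasurableSet (cube a) :=
  MeasurableSet.univ_pi' (fun _ => measurableSet_Ioc)

lemma cube_disj {n : ℕ} :
    Pairwise (Function.onFun Disjoint fun m : Fin n → ℤ => cube (cvec m)) := by
  intro a b hab
  rw [Function.onFun, Set.disjoint_left]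
  intro x ha hb
  apply hab
  funext i
  obtain ⟨h1, h2⟩ := ha i
  obtain ⟨h3, h4⟩ := hb i
  simp only [cvec] at h1 h2 h3 h4
  have h5 : (a i : ℝ) < b i + 1 := by linarith
  have h6 : (b i : ℝ) < a i + 1 := by linarith
  norm_cast at h5 h6
  omega

lemma cube_union {n : ℕ} : (⋃ m : Fin n → ℤ, cube (cvec m)) = Set.univ := by
  rw [Set.eq_univ_iff_forall]
  intro x
  rw [Set.mem_iUnion]
  refine ⟨fun i => ⌈x i⌉ - 1, fun i => ?_⟩
  simp only [cvec, Set.mem_Ioc]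
  push_cast
  constructor
  · linarith [Int.ceil_lt_add_one (x i)]
  · linarith [Int.le_ceil (x i)]

lemma hasSum_cube {n : ℕ} {G : Type*} [NormedAddCommGroup G] [NormedSpace ℝ G]
    (h : (Fin n → ℝ) → G) (hi : Integrable h) :
    HasSum (fun m : Fin n → ℤ => ∫ x in cube 0, h (x + cvec m)) (∫ x, h x) := by
  have h1 := hasSum_integral_iUnion (μ := volume) (f := h) (fun m : Fin n → ℤ => cube_meas (cvec m))
    cube_disj hi.integrableOn
  rw [cube_union, setIntegral_univ] at h1
  refine h1.congr_fun ?_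
  intro m
  have h2 := (measurePreserving_add_right volume (cvec m)).setIntegral_preimage_emb
    (measurableEmbedding_addRight (cvec m)) h (cube (cvec m))
  rw [← h2]
  congr 2
  ext x
  simp only [cube, Set.mem_preimage, Set.mem_ofPred_eq, Set.mem_Ioc, Pi.add_apply, Pi.zero_apply]
  refine forall_congr' fun i => ?_
  constructor <;> rintro ⟨h1, h2⟩ <;> constructor <;> linarith

lemma integral_periodization {n : ℕ} {G : Type*} [NormedAddCommGroup G] [NormedSpace ℝ G]
    [CompleteSpace G]
    (h : (Fin n → ℝ) → G) (hi : Integrable h) :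
    ∫ x in cube 0, (∑' m : Fin n → ℤ, h (x + cvec m)) = ∫ x, h x := by
  have h1 := hasSum_cube h hi
  have h2 := hasSum_cube _ hi.norm
  have h3 := hasSum_integral_of_summable_integral_norm (μ := volume.restrict (cube 0))
    (F := fun (m : Fin n → ℤ) x => h (x + cvec m))
    (fun m => (hi.comp_add_right (cvec m)).integrableOn) h2.summable
  exact h3.unique h1

/-- The exponential `exp(-2πi k·x)`. -/
def ek {n : ℕ} (k : Fin n → ℤ) (x : Fin n → ℝ) : ℂ :=
  Complex.exp (((-2 * π * ∑ i, (k i : ℝ) * x i : ℝ) : ℂ) * Complex.I)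

lemma ek_eq {n : ℕ} (k : Fin n → ℤ) (x : Fin n → ℝ) :
    UnitAddTorus.mFourier (-k) (fun i => (x i : UnitAddCircle)) = ek k x := by
  simp only [UnitAddTorus.mFourier, ContinuousMap.coe_mk, ek]
  simp_rw [fourier_coe_apply]
  rw [← Complex.exp_sum]
  congr 1
  push_cast
  rw [Finset.mul_sum, Finset.sum_mul]
  refine Finset.sum_congr rfl fun i _ => ?_
  simp
  ring

lemma coe_add_cvec {n : ℕ} (x : Fin n → ℝ) (m : Fin n → ℤ) (i : Fin n) :
    (((x + cvec m) i : ℝ) : UnitAddCircle) = (x i : UnitAddCircle) := by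
  simp [cvec]

lemma ek_add {n : ℕ} (k : Fin n → ℤ) (x : Fin n → ℝ) (m : Fin n → ℤ) :
    ek k (x + cvec m) = ek k x := by
  rw [← ek_eq, ← ek_eq]
  congr 1
  funext i
  exact coe_add_cvec x m i

lemma ek_norm {n : ℕ} (k : Fin n → ℤ) (x : Fin n → ℝ) : ‖ek k x‖ = 1 :=
  Complex.norm_exp_ofReal_mul_I _

lemma ek_cont {n : ℕ} (k : Fin n → ℤ) : Continuous (ek k) := by
  unfold ek; fun_prop

/-- Poisson summation for `ℤ^n`. -/
lemma poisson_Zn {n : ℕ} (g : SchwartzMap (Fin n → ℝ) ℂ)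
    (hs : Summable fun k : Fin n → ℤ => ∫ x, ek k x * g x) :
    HasSum (fun k : Fin n → ℤ => ∫ x, ek k x * g x) (∑' m : Fin n → ℤ, g (cvec m)) := by
  set P : (Fin n → ℝ) → ℂ := fun x => ∑' m : Fin n → ℤ, g (x + cvec m) with hP
  have hPc : Continuous P := schwartz_periodization_continuous g
  have hPper : ∀ x m, P (x + cvec m) = P x := by
    intro x m
    simp only [hP]
    rw [← (Equiv.addLeft m).tsum_eq (fun m' => g (x + cvec m'))]
    refine tsum_congr fun m' => ?_
    congr 1
    funext i
    simp [cvec, add_assoc]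
  let q : (Fin n → ℝ) → UnitAddTorus (Fin n) := Pi.map fun _ => ((↑) : ℝ → UnitAddCircle)
  have hq : IsOpenQuotientMap q :=
    IsOpenQuotientMap.piMap fun _ => QuotientAddGroup.isOpenQuotientMap_mk
  let F₀ : UnitAddTorus (Fin n) → ℂ := fun t => P (Function.surjInv hq.surjective t)
  have hF₀ : ∀ x, F₀ (q x) = P x := by
    intro x
    have h1 : q (Function.surjInv hq.surjective (q x)) = q x := Function.surjInv_eq _ _
    set y := Function.surjInv hq.surjective (q x) with hy
    have h2 : ∀ i, ∃ m : ℤ, y i = x i + m := by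
      intro i
      have h3 : ((y i : ℝ) : UnitAddCircle) = (x i : UnitAddCircle) := congrFun h1 i
      rw [← sub_eq_zero, ← AddCircle.coe_sub, AddCircle.coe_eq_zero_iff] at h3
      obtain ⟨m, hm⟩ := h3
      refine ⟨m, ?_⟩
      simp at hm
      linarith
    choose m hm using h2
    have h4 : y = x + cvec m := by funext i; exact hm i
    change P y = P x
    rw [h4, hPper]
  let F : C(UnitAddTorus (Fin n), ℂ) := ⟨F₀, by
    rw [hq.isQuotientMap.continuous_iff]
    convert hPc using 1
    funext x
    exact hF₀ x⟩
  have hcoef : ∀ k, UnitAddTorus.mFourierCoeff F k = ∫ x, ek k x * g x := by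
    intro k
    rw [UnitAddTorus.mFourierCoeff_eq_integral F k 0]
    have hi : Integrable (fun x => ek k x * g x) := by
      refine (g.integrable (μ := volume)).bdd_mul (c := 1) (ek_cont k).aestronglyMeasurable ?_
      exact Filter.Eventually.of_forall fun x => (ek_norm k x).le
    rw [← integral_periodization _ hi]
    refine integral_congr_ae (Filter.Eventually.of_forall fun x => ?_)
    change UnitAddTorus.mFourier (-k) (fun i => (x i : UnitAddCircle)) • F₀ (q x) = _
    rw [ek_eq, hF₀, smul_eq_mul]
    simp only [hP, ek_add]
    rw [tsum_mul_left]
  have hs' : Summable (UnitAddTorus.mFourierCoeff F) := by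
    refine hs.congr fun k => (hcoef k).symm
  have := UnitAddTorus.hasSum_mFourier_series_apply_of_summable hs' (q 0)
  have h0 : F (q 0) = ∑' m : Fin n → ℤ, g (cvec m) := by
    change F₀ (q 0) = _
    rw [hF₀]
    simp [hP]
  rw [h0] at this
  refine this.congr_fun fun k => ?_
  rw [hcoef]
  have : UnitAddTorus.mFourier k (q 0) = 1 := by
    have h := ek_eq (-k) (0 : Fin n → ℝ)
    rw [neg_neg] at h
    change UnitAddTorus.mFourier k (fun i => (((0 : Fin n → ℝ) i : ℝ) : UnitAddCircle)) = 1
    rw [h]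
    simp [ek]
  rw [this]; simp

lemma integral_lattice_coords {n : ℕ} (L : Submodule ℤ (EuclideanSpace ℝ (Fin n)))
    [DiscreteTopology L] [IsZLattice ℝ L] (b : Module.Basis (Fin n) ℤ L)
    (A : (Fin n → ℝ) ≃L[ℝ] EuclideanSpace ℝ (Fin n))
    (hA : ∀ x, A x = (b.ofZLatticeBasis ℝ L).equivFun.symm x)
    (φ : EuclideanSpace ℝ (Fin n) → ℂ) :
    ∫ x, φ (A x) = ((ZLattice.covolume L)⁻¹ : ℝ) • ∫ y, φ y := by
  set ν : Measure (EuclideanSpace ℝ (Fin n)) := (volume : Measure (Fin n → ℝ)).map A with hν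
  have : ν.IsAddHaarMeasure := A.isAddHaarMeasure_map volume
  have h1 := Measure.isAddLeftInvariant_eq_smul (volume : Measure (EuclideanSpace ℝ (Fin n))) ν
  set c := Measure.addHaarScalarFactor (volume : Measure (EuclideanSpace ℝ (Fin n))) ν
  have h2 : ν (ZSpan.fundamentalDomain (b.ofZLatticeBasis ℝ L)) = 1 := by
    rw [hν, Measure.map_apply A.continuous.measurable (ZSpan.fundamentalDomain_measurableSet _)]
    have : A ⁻¹' (ZSpan.fundamentalDomain (b.ofZLatticeBasis ℝ L)) =
        Set.univ.pi fun _ => Set.Ico (0 : ℝ) 1 := by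
      ext x
      simp only [Set.mem_preimage, ZSpan.mem_fundamentalDomain, hA, Set.mem_univ_pi]
      refine forall_congr' fun i => ?_
      rw [← Module.Basis.equivFun_apply, LinearEquiv.apply_symm_apply]
    rw [this, Real.volume_pi_Ico]
    simp
  have h3 : ZLattice.covolume L = (c : ℝ) := by
    rw [ZLattice.covolume_eq_measure_fundamentalDomain L volume
      (ZLattice.isAddFundamentalDomain b volume), Measure.real, h1]
    simp [h2]
  have h4 : ∫ x, φ (A x) = ∫ y, φ y ∂ν := by
    exact (A.toHomeomorph.measurableEmbedding.integral_map (μ := volume) φ).symm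
  have hc : (c : ℝ) ≠ 0 := by
    rw [← h3]; exact ZLattice.covolume_ne_zero L volume
  rw [h4, h3]
  conv_rhs => rw [h1]
  rw [integral_smul_nnreal_measure, NNReal.smul_def, smul_smul, inv_mul_cancel₀ hc, one_smul]

/-- **Vanishing for special Cohn–Elkies functions.** If `f` is a Cohn–Elkies function of
dimension `n` and size `ℓ_L` (the shortest nonzero vector length of `L`) and moreover
`1/covol L = f 0 / 𝓕 f 0`, then `f` vanishes on `L ∖ {0}` and `𝓕 f` vanishes on the nonzero
vectors of the dual lattice `L^∨`. -/
theorem special_cohn_elkies_vanishing (n : ℕ) (ℓL : ℝ)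
    (f : SchwartzMap (EuclideanSpace ℝ (Fin n)) ℂ)
    (hf_real : ∀ x, (f x).im = 0)
    (hFf_real : ∀ ξ, (𝓕 (f : EuclideanSpace ℝ (Fin n) → ℂ) ξ).im = 0)
    (hf_neg : ∀ x : EuclideanSpace ℝ (Fin n), ℓL ≤ ‖x‖ → (f x).re ≤ 0)
    (hFf_nonneg : ∀ ξ, 0 ≤ (𝓕 (f : EuclideanSpace ℝ (Fin n) → ℂ) ξ).re)
    (hFf0 : 0 < (𝓕 (f : EuclideanSpace ℝ (Fin n) → ℂ) 0).re)
    (L : Submodule ℤ (EuclideanSpace ℝ (Fin n)))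
    [DiscreteTopology L] [IsZLattice ℝ L]
    -- `ℓL` is the shortest length of `L`:
    (hshort : IsLeast {r : ℝ | ∃ v ∈ L, v ≠ 0 ∧ ‖v‖ = r} ℓL)
    -- the special condition `1/covol L = f 0 / 𝓕 f 0`:
    (hspecial : 1 / ZLattice.covolume L
      = (f 0).re / (𝓕 (f : EuclideanSpace ℝ (Fin n) → ℂ) 0).re) :
    (∀ v ∈ L, v ≠ 0 → f v = 0) ∧
    (∀ w : EuclideanSpace ℝ (Fin n),
      (∀ v ∈ L, ∃ m : ℤ, ⟪w, v⟫ = (m : ℝ)) → w ≠ 0 →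
      𝓕 (f : EuclideanSpace ℝ (Fin n) → ℂ) w = 0) := by
  classical
  have : Module.Finite ℤ L := ZLattice.module_finite ℝ L
  have : Module.Free ℤ L := ZLattice.module_free ℝ L
  have hrank : Module.finrank ℤ L = n := by rw [ZLattice.rank ℝ]; simp
  let b : Module.Basis (Fin n) ℤ L := Module.finBasisOfFinrankEq ℤ L hrank
  let B := b.ofZLatticeBasis ℝ L
  let A : (Fin n → ℝ) ≃L[ℝ] EuclideanSpace ℝ (Fin n) :=
    B.equivFun.symm.toContinuousLinearEquiv
  have hA : ∀ x, A x = B.equivFun.symm x := fun x => rfl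
  have hA' : ∀ x, A x = ∑ i, x i • (b i : EuclideanSpace ℝ (Fin n)) := by
    intro x
    rw [hA, Module.Basis.equivFun_symm_apply]
    simp [B]
  -- dual coordinates
  let D₀ : EuclideanSpace ℝ (Fin n) →ₗ[ℝ] (Fin n → ℝ) :=
    LinearMap.pi fun i => (innerₗ (EuclideanSpace ℝ (Fin n))).flip (B i)
  have hD₀ : ∀ w i, D₀ w i = ⟪w, B i⟫ := fun w i => rfl
  have hD₀inj : Function.Injective D₀ := by
    intro w w' h
    refine InnerProductSpace.ext_inner_right_basis (𝕜 := ℝ) B fun i => ?_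
    exact congrFun h i
  let D : EuclideanSpace ℝ (Fin n) ≃L[ℝ] (Fin n → ℝ) :=
    (LinearMap.linearEquivOfInjective D₀ hD₀inj (by simp)).toContinuousLinearEquiv
  have hD : ∀ w i, D w i = ⟪w, B i⟫ := fun w i => rfl
  have hDA : ∀ w x, ⟪w, A x⟫ = ∑ i, D w i * x i := by
    intro w x
    rw [hA, Module.Basis.equivFun_symm_apply, inner_sum]
    refine Finset.sum_congr rfl fun i _ => ?_
    rw [inner_smul_right, hD, mul_comm]
  let g : SchwartzMap (Fin n → ℝ) ℂ := SchwartzMap.compCLMOfContinuousLinearEquiv ℂ A f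
  have hg : ∀ x, g x = f (A x) := fun x => rfl
  let h : SchwartzMap (Fin n → ℝ) ℂ := SchwartzMap.compCLMOfContinuousLinearEquiv ℂ D.symm (𝓕 f)
  have hh : ∀ x, h x = 𝓕 (f : EuclideanSpace ℝ (Fin n) → ℂ) (D.symm x) := fun x => rfl
  set V := ZLattice.covolume L with hV
  have hVpos : 0 < V := ZLattice.covolume_pos L volume
  have hcoef : ∀ k : Fin n → ℤ, ∫ x, ek k x * g x = (V⁻¹ : ℝ) • h (cvec k) := by
    intro k
    rw [hh, Real.fourier_eq', ← integral_lattice_coords L b A hA]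
    refine integral_congr_ae (Filter.Eventually.of_forall fun x => ?_)
    change ek k x * f (A x) = Complex.exp _ • f (A x)
    rw [real_inner_comm, hDA, D.apply_symm_apply]
    rfl
  have hsum : Summable fun k : Fin n → ℤ => ∫ x, ek k x * g x := by
    simp_rw [hcoef]
    have := schwartz_summable h 0
    simp only [zero_add] at this
    exact this.const_smul _
  have hP := poisson_Zn g hsum
  have hgs : Summable fun m : Fin n → ℤ => g (cvec m) := by
    simpa using schwartz_summable g 0
  have hu := Complex.hasSum_re hgs.hasSum
  have hv := Complex.hasSum_re hP
  set S : ℝ := (∑' m : Fin n → ℤ, g (cvec m)).re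
  simp_rw [hcoef] at hv
  have hc0 : cvec (0 : Fin n → ℤ) = 0 := by funext i; simp [cvec]
  have hmem : ∀ m : Fin n → ℤ, A (cvec m) ∈ L := by
    intro m
    rw [hA']
    refine Submodule.sum_mem _ fun i _ => ?_
    have : cvec m i • (b i : EuclideanSpace ℝ (Fin n)) = m i • (b i : EuclideanSpace ℝ (Fin n)) := by
      exact Int.cast_smul_eq_zsmul ℝ (m i) _
    rw [this]
    exact L.smul_mem _ (b i).2
  have hu_neg : ∀ m : Fin n → ℤ, m ≠ 0 → (g (cvec m)).re ≤ 0 := by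
    intro m hm
    rw [hg]
    apply hf_neg
    refine hshort.2 ⟨_, hmem m, ?_, rfl⟩
    intro h0
    rw [map_eq_zero_iff _ A.injective] at h0
    exact hm (cvec_inj (h0.trans hc0.symm))
  have hv_nonneg : ∀ k : Fin n → ℤ, 0 ≤ ((V⁻¹ : ℝ) • h (cvec k)).re := by
    intro k
    rw [Complex.smul_re, hh]
    exact mul_nonneg (inv_nonneg.mpr hVpos.le) (hFf_nonneg _)
  have h00 : (g (cvec 0)).re = ((V⁻¹ : ℝ) • h (cvec 0)).re := by
    rw [Complex.smul_re, hh, hg, hc0, A.map_zero, D.symm.map_zero, smul_eq_mul]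
    field_simp at hspecial ⊢
    linarith
  -- upper bounds from the lattice side
  have hS_le : ∀ m : Fin n → ℤ, m ≠ 0 → S ≤ (g (cvec 0)).re + (g (cvec m)).re := by
    intro m hm
    have := sum_le_hasSum (f := fun m => -(g (cvec m)).re) {0, m} (fun i hi => ?_) hu.neg
    · rw [Finset.sum_pair hm.symm] at this
      linarith
    · have : i ≠ 0 := fun h => hi (by simp [h])
      linarith [hu_neg i this]
  have hS_le0 : S ≤ (g (cvec 0)).re := by
    have := sum_le_hasSum (f := fun m => -(g (cvec m)).re) {0} (fun i hi => ?_) hu.neg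
    · rw [Finset.sum_singleton] at this
      linarith
    · have : i ≠ 0 := fun h => hi (by simp [h])
      linarith [hu_neg i this]
  have hS_ge : ∀ k : Fin n → ℤ, k ≠ 0 →
      ((V⁻¹ : ℝ) • h (cvec 0)).re + ((V⁻¹ : ℝ) • h (cvec k)).re ≤ S := by
    intro k hk
    have := sum_le_hasSum {0, k} (fun i _ => hv_nonneg i) hv
    rwa [Finset.sum_pair hk.symm] at this
  have hS_ge0 : ((V⁻¹ : ℝ) • h (cvec 0)).re ≤ S := by
    have := sum_le_hasSum {0} (fun i _ => hv_nonneg i) hv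
    rwa [Finset.sum_singleton] at this
  constructor
  · intro v hv hv0
    let m : Fin n → ℤ := fun i => b.repr ⟨v, hv⟩ i
    have hm : A (cvec m) = v := by
      have h1 := congrArg Subtype.val (b.sum_repr ⟨v, hv⟩)
      rw [hA']
      rw [AddSubmonoidClass.coe_finsetSum] at h1
      refine Eq.trans (Finset.sum_congr rfl fun i _ => ?_) h1
      exact Int.cast_smul_eq_zsmul ℝ (m i) _
    have hm0 : m ≠ 0 := by
      intro h0
      apply hv0
      rw [← hm, h0, hc0, map_zero]
    have h1 := hS_le m hm0
    have h2 := hu_neg m hm0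
    rw [hg (cvec m), hm] at h1 h2
    apply Complex.ext
    · simp only [Complex.zero_re]; linarith
    · exact hf_real v
  · intro w hw hw0
    have h1 : ∀ i, ∃ m : ℤ, ⟪w, (b i : EuclideanSpace ℝ (Fin n))⟫ = (m : ℝ) :=
      fun i => hw _ (b i).2
    choose k hk using h1
    have hk' : cvec k = D w := by
      funext i
      rw [hD]
      simp [B, cvec, hk]
    have hk0 : k ≠ 0 := by
      intro h0
      apply hw0
      rw [h0, hc0] at hk'
      exact (map_eq_zero_iff _ D.injective).mp hk'.symm
    have h1 := hS_ge k hk0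
    have h2 : ((V⁻¹ : ℝ) • h (cvec k)).re ≤ 0 := by linarith
    rw [Complex.smul_re, hh, hk', D.symm_apply_apply, smul_eq_mul] at h2
    have h3 : 0 < V⁻¹ := inv_pos.mpr hVpos
    apply Complex.ext
    · simp only [Complex.zero_re]
      have := hFf_nonneg w
      exact le_antisymm (nonpos_of_mul_nonpos_right h2 h3) this
    · exact hFf_real w
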